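/- arXiv:1802.08413 — 3 statements merged into one kernel-verified Lean document; each statement's English description precedes it below -/
import Mathlib

section
/- For every smooth compactly supported vector field u : ℝ² → ℝ², the L⁴ norm of u satisfies ‖u‖_{L⁴}² ≤ √2 · ‖u‖_{L²} · ‖∇u‖_{L²}; equivalently, ∫_{ℝ²} |u(x)|⁴ dx ≤ 2 (∫_{ℝ²} |u(x)|² dx)(∫_{ℝ²} |∇u(x)|² dx). -/
open MeasureTheory

/-- Squared Frobenius (Hilbert–Schmidt) norm of a continuous linear map on `ℝ²`. -/
noncomputable def frobSq2 (L : EuclideanSpace ℝ (Fin 2) →L[ℝ] EuclideanSpace ℝ (Fin 2)) : ℝ :=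
  ∑ i : Fin 2, ∑ j : Fin 2, (L (EuclideanSpace.single j 1) i) ^ 2

abbrev LadyE := EuclideanSpace ℝ (Fin 2)

lemma lady_line_isometry (e c : LadyE) (he : ‖e‖ = 1) :
    Isometry (fun t : ℝ => c + t • e) := by
  refine Isometry.of_dist_eq fun s t => ?_
  rw [dist_add_left, dist_eq_norm, ← sub_smul, norm_smul, he, mul_one, dist_eq_norm]

lemma lady_slice (u : LadyE → LadyE) (hu : ContDiff ℝ (⊤ : ℕ∞) u) (hsupp : HasCompactSupport u)
    (e c : LadyE) (he : ‖e‖ = 1) (s : ℝ) :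
    ‖u (c + s • e)‖ ^ 2 ≤
      ∫ t : ℝ, 2 * (‖u (c + t • e)‖ * ‖fderiv ℝ u (c + t • e) e‖) := by
  have hiso := lady_line_isometry e c he
  have hcl := hiso.isClosedEmbedding
  have hc : Continuous (fun t : ℝ => c + t • e) := hiso.continuous
  have hu0 : Continuous u := hu.continuous
  have hfd : Continuous (fderiv ℝ u) := hu.continuous_fderiv (by simp)
  have hw : HasCompactSupport (fun t : ℝ => u (c + t • e)) := hsupp.comp_isClosedEmbedding hcl
  have hd : ∀ t : ℝ, HasDerivAt (fun t : ℝ => ‖u (c + t • e)‖ ^ 2)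
      (2 * inner ℝ (u (c + t • e)) (fderiv ℝ u (c + t • e) e)) t := by
    intro t
    have h1 : HasDerivAt (fun t : ℝ => c + t • e) e t := by
      simpa using ((hasDerivAt_id t).smul_const e).const_add c
    have h2 := ((hu.differentiable (by simp)) (c + t • e)).hasFDerivAt.comp_hasDerivAt t h1
    exact h2.norm_sq
  have hcont : Continuous
      (fun t : ℝ => 2 * inner ℝ (u (c + t • e)) (fderiv ℝ u (c + t • e) e)) := by fun_prop
  have hint : Integrable
      (fun t : ℝ => 2 * inner ℝ (u (c + t • e)) (fderiv ℝ u (c + t • e) e)) := by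
    refine hcont.integrable_of_hasCompactSupport (hw.mono ?_)
    intro t ht h
    apply ht
    simp at h
    simp [h]
  have hint2 : Integrable
      (fun t : ℝ => 2 * (‖u (c + t • e)‖ * ‖fderiv ℝ u (c + t • e) e‖)) := by
    refine Continuous.integrable_of_hasCompactSupport (by fun_prop) (hw.mono ?_)
    intro t ht h
    apply ht
    simp at h
    simp [h]
  have hcs : HasCompactSupport (fun t : ℝ => ‖u (c + t • e)‖ ^ 2) := by
    refine hw.mono ?_
    intro t ht h
    apply ht
    simp at h
    simp [h]
  have hC1 : ContDiff ℝ 1 (fun t : ℝ => ‖u (c + t • e)‖ ^ 2) := by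
    have : ContDiff ℝ 1 u := hu.of_le (by simp)
    have h : ContDiff ℝ 1 (fun t : ℝ => u (c + t • e)) := by fun_prop
    exact h.norm_sq ℝ
  have hftc := hcs.integral_Iic_deriv_eq hC1 s
  have hde : deriv (fun t : ℝ => ‖u (c + t • e)‖ ^ 2) =
      (fun t : ℝ => 2 * inner ℝ (u (c + t • e)) (fderiv ℝ u (c + t • e) e)) :=
    funext fun t => (hd t).deriv
  rw [hde] at hftc
  rw [← hftc]
  calc _ ≤ ∫ t in Set.Iic s, 2 * (‖u (c + t • e)‖ * ‖fderiv ℝ u (c + t • e) e‖) := by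
        refine setIntegral_mono hint.integrableOn hint2.integrableOn fun t => ?_
        have := real_inner_le_norm (u (c + t • e)) (fderiv ℝ u (c + t • e) e)
        simp only
        linarith
    _ ≤ _ := setIntegral_le_integral hint2 (Filter.Eventually.of_forall fun t => by positivity)

lemma lady_cs {X : Type*} [MeasurableSpace X] (μ : Measure X) (f g : X → ℝ)
    (hff : Integrable (fun x => f x ^ 2) μ) (hgg : Integrable (fun x => g x ^ 2) μ)
    (hfg : Integrable (fun x => f x * g x) μ) :
    (∫ x, f x * g x ∂μ) ^ 2 ≤ (∫ x, f x ^ 2 ∂μ) * ∫ x, g x ^ 2 ∂μ := by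
  have h : ∀ t : ℝ, 0 ≤ (∫ x, f x ^ 2 ∂μ) * (t * t) + (2 * ∫ x, f x * g x ∂μ) * t
      + ∫ x, g x ^ 2 ∂μ := by
    intro t
    have : 0 ≤ ∫ x, (t * f x + g x) ^ 2 ∂μ := integral_nonneg fun x => sq_nonneg _
    have e : ∫ x, (t * f x + g x) ^ 2 ∂μ
        = ∫ x, ((t * t) * f x ^ 2 + (2 * t) * (f x * g x) + g x ^ 2) ∂μ := by
      congr 1; ext x; ring
    have hi : Integrable (fun x => (t * t) * f x ^ 2 + (2 * t) * (f x * g x)) μ :=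
      (hff.const_mul _).add (hfg.const_mul _)
    rw [e, integral_add hi hgg,
      integral_add (hff.const_mul _) (hfg.const_mul _), integral_const_mul,
      integral_const_mul] at this
    linarith
  have := discrim_le_zero h
  unfold discrim at this
  nlinarith

noncomputable def ladyPhi : ℝ × ℝ ≃ᵐ LadyE :=
  MeasurableEquiv.finTwoArrow.symm.trans (MeasurableEquiv.toLp 2 (Fin 2 → ℝ))

lemma ladyPhi_mp : MeasurePreserving ladyPhi :=
  (PiLp.volume_preserving_toLp (Fin 2)).comp
    (volume_preserving_finTwoArrow ℝ).symm

lemma ladyPhi_apply0 (x y : ℝ) : ladyPhi (x, y) =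
    (EuclideanSpace.single 1 y : LadyE) + x • EuclideanSpace.single 0 1 := by
  ext i; fin_cases i <;> simp [ladyPhi, MeasurableEquiv.finTwoArrow]

lemma ladyPhi_apply1 (x y : ℝ) : ladyPhi (x, y) =
    (EuclideanSpace.single 0 x : LadyE) + y • EuclideanSpace.single 1 1 := by
  ext i; fin_cases i <;> simp [ladyPhi, MeasurableEquiv.finTwoArrow]

lemma frobSq2_eq (L : LadyE →L[ℝ] LadyE) : frobSq2 L =
    ‖L (EuclideanSpace.single 0 1)‖ ^ 2 + ‖L (EuclideanSpace.single 1 1)‖ ^ 2 := by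
  simp [frobSq2, EuclideanSpace.norm_sq_eq]; ring

/-- Ladyzhenskaya inequality in dimension 2:
`∫ |u|⁴ ≤ 2 (∫ |u|²)(∫ |∇u|²)` for smooth compactly supported `u : ℝ² → ℝ²`. -/
theorem ladyzhenskaya_dim2
    (u : EuclideanSpace ℝ (Fin 2) → EuclideanSpace ℝ (Fin 2))
    (hu : ContDiff ℝ (⊤ : ℕ∞) u) (hsupp : HasCompactSupport u) :
    ∫ x, ‖u x‖ ^ 4 ≤ 2 * (∫ x, ‖u x‖ ^ 2) * ∫ x, frobSq2 (fderiv ℝ u x) := by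
  have hu0 : Continuous u := hu.continuous
  have hfd : Continuous (fderiv ℝ u) := hu.continuous_fderiv (by simp)
  have key : ∀ F : LadyE → ℝ, Continuous F → (∀ x, u x = 0 → F x = 0) → Integrable F := by
    intro F hF h
    refine hF.integrable_of_hasCompactSupport (hsupp.mono ?_)
    intro t ht h'
    exact ht (h t h')
  let e : Fin 2 → LadyE := fun i => EuclideanSpace.single i 1
  have he : ∀ i, ‖e i‖ = 1 := fun i => by simp [e]
  let A : Fin 2 → LadyE → ℝ := fun i x => 2 * (‖u x‖ * ‖fderiv ℝ u x (e i)‖)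
  have hA : ∀ i, Integrable (A i) := fun i => key _ (by fun_prop) (fun x hx => by simp [A, hx])
  have hA0 : ∀ i, 0 ≤ ∫ x, A i x := fun i => integral_nonneg fun x => by positivity
  have h2 : Integrable (fun x => ‖u x‖ ^ 2) := key _ (by fun_prop) (fun x hx => by simp [hx])
  have h4 : Integrable (fun x => ‖u x‖ ^ 4) := key _ (by fun_prop) (fun x hx => by simp [hx])
  have hD : ∀ i, Integrable (fun x => ‖fderiv ℝ u x (e i)‖ ^ 2) := by
    intro i
    refine Continuous.integrable_of_hasCompactSupport (by fun_prop)
      ((hsupp.fderiv (𝕜 := ℝ)).mono ?_)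
    intro t ht h'
    exact ht (by simp [h'])
  have hcs : ∀ i, (∫ x, A i x) ^ 2 ≤
      4 * ((∫ x, ‖u x‖ ^ 2) * ∫ x, ‖fderiv ℝ u x (e i)‖ ^ 2) := by
    intro i
    have h := lady_cs volume (fun x => ‖u x‖) (fun x => ‖fderiv ℝ u x (e i)‖) h2 (hD i)
      (key _ (by fun_prop) (fun x hx => by simp [hx]))
    simp only [A]
    rw [integral_const_mul]
    nlinarith
  have hAP : ∀ i, Integrable (fun p : ℝ × ℝ => A i (ladyPhi p)) := fun i =>
    (ladyPhi_mp.integrable_comp_emb ladyPhi.measurableEmbedding).2 (hA i)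
  have hAI : ∀ i, ∫ p : ℝ × ℝ, A i (ladyPhi p) = ∫ x, A i x := fun i =>
    ladyPhi_mp.integral_comp ladyPhi.measurableEmbedding _
  have hmain : ∫ x, ‖u x‖ ^ 4 ≤ (∫ x, A 0 x) * ∫ x, A 1 x := by
    rw [← ladyPhi_mp.integral_comp ladyPhi.measurableEmbedding (fun x => ‖u x‖ ^ 4),
      ← hAI 0, ← hAI 1]
    have i0 : Integrable (fun y : ℝ => ∫ x : ℝ, A 0 (ladyPhi (x, y))) :=
      (hAP 0).integral_prod_right
    have i1 : Integrable (fun x : ℝ => ∫ y : ℝ, A 1 (ladyPhi (x, y))) :=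
      (hAP 1).integral_prod_left
    have e0 : ∫ p : ℝ × ℝ, A 0 (ladyPhi p) = ∫ y : ℝ, ∫ x : ℝ, A 0 (ladyPhi (x, y)) :=
      integral_prod_symm _ (hAP 0)
    have e1 : ∫ p : ℝ × ℝ, A 1 (ladyPhi p) = ∫ x : ℝ, ∫ y : ℝ, A 1 (ladyPhi (x, y)) :=
      integral_prod _ (hAP 1)
    rw [e0, e1, mul_comm, ← integral_prod_mul]
    refine integral_mono ((ladyPhi_mp.integrable_comp_emb ladyPhi.measurableEmbedding).2 h4)
      (i1.mul_prod i0) ?_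
    rintro ⟨x, y⟩
    have s0 := lady_slice u hu hsupp (e 0) (EuclideanSpace.single 1 y) (he 0) x
    have s1 := lady_slice u hu hsupp (e 1) (EuclideanSpace.single 0 x) (he 1) y
    simp only [e, ← ladyPhi_apply0] at s0
    simp only [e, ← ladyPhi_apply1] at s1
    have := mul_le_mul s1 s0 (by positivity) (le_trans (by positivity) s1)
    simp only [A, e]
    refine le_trans (le_of_eq ?_) this
    ring
  have hfrob : ∫ x, frobSq2 (fderiv ℝ u x) =
      (∫ x, ‖fderiv ℝ u x (e 0)‖ ^ 2) + ∫ x, ‖fderiv ℝ u x (e 1)‖ ^ 2 := by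
    rw [← integral_add (hD 0) (hD 1)]
    simp only [frobSq2_eq, e]
  rw [hfrob]
  have := hcs 0
  have := hcs 1
  nlinarith [sq_nonneg ((∫ x, A 0 x) - ∫ x, A 1 x)]
end

section
/- Let u : ℝ² → ℝ² be a smooth compactly supported divergence-free vector field and let v, w : ℝ² → ℝ² be smooth compactly supported vector fields. Then |b(u,v,w)| ≤ √2 · ‖u‖_{L²}^{1/2} ‖∇u‖_{L²}^{1/2} ‖v‖_{L²}^{1/2} ‖∇v‖_{L²}^{1/2} ‖∇w‖_{L²}. -/
open MeasureTheory

/-- The Navier–Stokes trilinear form on `ℝ²`: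
`b(u,v,w) = ∫ Σᵢⱼ uᵢ ∂vⱼ/∂xᵢ wⱼ dx`. -/
noncomputable def trilinearB
    (u v w : EuclideanSpace ℝ (Fin 2) → EuclideanSpace ℝ (Fin 2)) : ℝ :=
  ∫ x, ∑ i : Fin 2, ∑ j : Fin 2,
    u x i * fderiv ℝ v x (EuclideanSpace.single i 1) j * w x j

lemma aux_cs {f g : EuclideanSpace ℝ (Fin 2) → ℝ} (hf : Continuous f) (hfs : HasCompactSupport f)
    (hg : Continuous g) (hgs : HasCompactSupport g) :
    (∫ x, f x * g x) ^ 2 ≤ (∫ x, f x ^ 2) * ∫ x, g x ^ 2 := by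
  have i1 : Integrable (fun x => f x ^ 2) :=
    (hf.pow 2).integrable_of_hasCompactSupport (by simpa only [pow_two] using hfs.mul_right)
  have i2 : Integrable (fun x => g x ^ 2) :=
    (hg.pow 2).integrable_of_hasCompactSupport (by simpa only [pow_two] using hgs.mul_right)
  have i3 : Integrable (fun x => f x * g x) :=
    (hf.mul hg).integrable_of_hasCompactSupport hfs.mul_right
  have key : ∀ t : ℝ, 0 ≤ (∫ x, f x ^ 2) * (t * t) + (2 * ∫ x, f x * g x) * t + ∫ x, g x ^ 2 := by
    intro t
    have h0 : 0 ≤ ∫ x, (t * f x + g x) ^ 2 := integral_nonneg fun x => sq_nonneg _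
    have h1 : ∫ x, (t * f x + g x) ^ 2 =
        ∫ x, ((t * t) * f x ^ 2 + (2 * t) * (f x * g x) + g x ^ 2) := by
      congr 1; ext x; ring
    rw [h1, integral_add (by fun_prop) i2, integral_add (by fun_prop) (by fun_prop),
      integral_const_mul, integral_const_mul] at h0
    linarith
  have := discrim_le_zero key
  unfold discrim at this
  nlinarith

lemma aux_line {u : EuclideanSpace ℝ (Fin 2) → EuclideanSpace ℝ (Fin 2)}
    (hu : ContDiff ℝ (⊤ : ℕ∞) u) (hus : HasCompactSupport u)
    (x e : EuclideanSpace ℝ (Fin 2)) (he : e ≠ 0) (t : ℝ) :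
    ‖u (x + t • e)‖ ^ 2 ≤
      ∫ s : ℝ, 2 * (‖u (x + s • e)‖ * ‖fderiv ℝ u (x + s • e) e‖) := by
  have hcl : Topology.IsClosedEmbedding (fun s : ℝ => x + s • e) :=
    (Homeomorph.addLeft x).isClosedEmbedding.comp (isClosedEmbedding_smul_left he)
  have hc : HasCompactSupport (fun s : ℝ => u (x + s • e)) := hus.comp_isClosedEmbedding hcl
  have hd : ContDiff ℝ (⊤ : ℕ∞) (fun s : ℝ => u (x + s • e)) := by fun_prop
  have hc2 : HasCompactSupport (fun s : ℝ => ‖u (x + s • e)‖ ^ 2) := by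
    simp only [pow_two]
    exact hc.norm.mul_right
  have hd2 : ContDiff ℝ 1 (fun s : ℝ => ‖u (x + s • e)‖ ^ 2) :=
    (hd.norm_sq ℝ).of_le (by exact_mod_cast le_top)
  rw [← hc2.integral_Iic_deriv_eq hd2 t]
  have hder : ∀ s : ℝ, deriv (fun s : ℝ => ‖u (x + s • e)‖ ^ 2) s =
      2 * inner ℝ (u (x + s • e)) (fderiv ℝ u (x + s • e) e) := by
    intro s
    have h1 : HasDerivAt (fun s : ℝ => x + s • e) e s := by
      simpa using ((hasDerivAt_id s).smul_const e).const_add x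
    have h2 : HasFDerivAt u (fderiv ℝ u (x + s • e)) (x + s • e) :=
      ((hu.differentiable (by simp)) _).hasFDerivAt
    exact (h2.comp_hasDerivAt s h1).norm_sq.deriv
  have hdu : Continuous (fun s : ℝ => fderiv ℝ u (x + s • e) e) := by
    have := hu.continuous_fderiv (by simp)
    fun_prop
  have hint : Integrable (fun s : ℝ => 2 * (‖u (x + s • e)‖ * ‖fderiv ℝ u (x + s • e) e‖)) := by
    apply Continuous.integrable_of_hasCompactSupport
    · have := hd.continuous
      fun_prop
    · exact (hc.norm.mul_right).mul_left
  have hint2 : Integrable (deriv (fun s : ℝ => ‖u (x + s • e)‖ ^ 2)) :=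
    (hd2.continuous_deriv le_rfl).integrable_of_hasCompactSupport hc2.deriv
  calc _ ≤ ∫ s in Set.Iic t, 2 * (‖u (x + s • e)‖ * ‖fderiv ℝ u (x + s • e) e‖) := by
        apply integral_mono hint2.integrableOn hint.integrableOn
        intro s
        simp only [hder]
        have := real_inner_le_norm (u (x + s • e)) (fderiv ℝ u (x + s • e) e)
        linarith
    _ ≤ _ := setIntegral_le_integral hint (Filter.Eventually.of_forall fun s => by positivity)

lemma aux_mp : MeasurePreserving
    (((MeasurableEquiv.finTwoArrow (α := ℝ)).symm).trans (MeasurableEquiv.toLp 2 (Fin 2 → ℝ))) :=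
  (PiLp.volume_preserving_toLp (Fin 2)).comp ((volume_preserving_finTwoArrow ℝ).symm _)

lemma aux_int (f : EuclideanSpace ℝ (Fin 2) → ℝ) :
    ∫ p : ℝ × ℝ, f !₂[p.1, p.2] = ∫ x, f x :=
  aux_mp.integral_comp' f

lemma aux_intble {f : EuclideanSpace ℝ (Fin 2) → ℝ} (hf : Integrable f) :
    Integrable (fun p : ℝ × ℝ => f !₂[p.1, p.2]) :=
  (aux_mp.integrable_comp_emb (MeasurableEquiv.measurableEmbedding _)).2 hf

lemma aux_prod {f g h : EuclideanSpace ℝ (Fin 2) → ℝ}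
    (hf0 : ∀ x, 0 ≤ f x) (hf : Integrable (fun x => f x ^ 2)) (hg : Integrable g)
    (hh : Integrable h)
    (h1 : ∀ a b : ℝ, f !₂[a, b] ≤ ∫ s : ℝ, g !₂[s, b])
    (h2 : ∀ a b : ℝ, f !₂[a, b] ≤ ∫ s : ℝ, h !₂[a, s]) :
    ∫ x, f x ^ 2 ≤ (∫ x, g x) * ∫ x, h x := by
  rw [← aux_int (fun x => f x ^ 2), ← aux_int g, ← aux_int h]
  have ig := aux_intble hg
  have ih := aux_intble hh
  rw [Measure.volume_eq_prod] at ig ih ⊢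
  rw [integral_prod_symm _ ig, integral_prod _ ih, mul_comm, ← integral_prod_mul]
  apply integral_mono
  · simpa only [Measure.volume_eq_prod] using aux_intble hf
  · exact ih.integral_prod_left.mul_prod ig.integral_prod_right
  · rintro ⟨a, b⟩
    simp only
    rw [pow_two]
    exact mul_le_mul (h2 a b) (h1 a b) (hf0 _) ((hf0 _).trans (h2 a b))

lemma aux_frob (L : EuclideanSpace ℝ (Fin 2) →L[ℝ] EuclideanSpace ℝ (Fin 2)) :
    frobSq2 L = ‖L (EuclideanSpace.single 0 1)‖ ^ 2 + ‖L (EuclideanSpace.single 1 1)‖ ^ 2 := by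
  simp only [frobSq2, EuclideanSpace.norm_sq_eq, Fin.sum_univ_two, Real.norm_eq_abs, sq_abs]
  ring

lemma aux_lady {u : EuclideanSpace ℝ (Fin 2) → EuclideanSpace ℝ (Fin 2)}
    (hu : ContDiff ℝ (⊤ : ℕ∞) u) (hus : HasCompactSupport u) :
    ∫ x, (‖u x‖ ^ 2) ^ 2 ≤ 2 * (∫ x, ‖u x‖ ^ 2) * ∫ x, frobSq2 (fderiv ℝ u x) := by
  have hcu := hu.continuous
  have hdu : ∀ e, Continuous (fun x => ‖fderiv ℝ u x e‖) := by
    intro e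
    have := hu.continuous_fderiv (by simp)
    fun_prop
  have hds : ∀ e, HasCompactSupport (fun x => ‖fderiv ℝ u x e‖) := fun e =>
    (hus.fderiv_apply (𝕜 := ℝ) e).norm
  have hi : ∀ e, Integrable (fun x => 2 * (‖u x‖ * ‖fderiv ℝ u x e‖)) := fun e =>
    ((hcu.norm.mul (hdu e)).integrable_of_hasCompactSupport hus.norm.mul_right).const_mul 2
  have hi2 : ∀ e, Integrable (fun x => ‖fderiv ℝ u x e‖ ^ 2) := fun e =>
    ((hdu e).pow 2).integrable_of_hasCompactSupport
      (by simpa only [pow_two] using (hds e).mul_right)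
  have hi4 : Integrable (fun x => (‖u x‖ ^ 2) ^ 2) :=
    ((hcu.norm.pow 2).pow 2).integrable_of_hasCompactSupport
      (by simpa only [pow_two] using (hus.norm.mul_right).mul_right)
  have hP := aux_prod (f := fun x => ‖u x‖ ^ 2) (fun x => by positivity) hi4
    (hi (EuclideanSpace.single 0 1)) (hi (EuclideanSpace.single 1 1))
    (by
      intro a b
      have key : ∀ s : ℝ, !₂[0, b] + s • EuclideanSpace.single (0 : Fin 2) (1 : ℝ) = !₂[s, b] := by
        intro s; ext i; fin_cases i <;> simp
      have := aux_line hu hus !₂[0, b] (EuclideanSpace.single 0 1) (by simp) a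
      simpa only [key] using this)
    (by
      intro a b
      have key : ∀ s : ℝ, !₂[a, 0] + s • EuclideanSpace.single (1 : Fin 2) (1 : ℝ) = !₂[a, s] := by
        intro s; ext i; fin_cases i <;> simp
      have := aux_line hu hus !₂[a, 0] (EuclideanSpace.single 1 1) (by simp) b
      simpa only [key] using this)
  simp only [aux_frob]
  rw [integral_add (hi2 _) (hi2 _)]
  rw [integral_const_mul, integral_const_mul] at hP
  have c0 := aux_cs hcu.norm hus.norm (hdu (EuclideanSpace.single 0 1)) (hds _)
  have c1 := aux_cs hcu.norm hus.norm (hdu (EuclideanSpace.single 1 1)) (hds _)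
  have p0 : 0 ≤ ∫ x, ‖u x‖ * ‖fderiv ℝ u x (EuclideanSpace.single 0 1)‖ :=
    integral_nonneg fun x => by positivity
  have p1 : 0 ≤ ∫ x, ‖u x‖ * ‖fderiv ℝ u x (EuclideanSpace.single 1 1)‖ :=
    integral_nonneg fun x => by positivity
  have pU : 0 ≤ ∫ x, ‖u x‖ ^ 2 := integral_nonneg fun x => by positivity
  have q0 : 0 ≤ ∫ x, ‖fderiv ℝ u x (EuclideanSpace.single 0 1)‖ ^ 2 :=
    integral_nonneg fun x => by positivity
  have q1 : 0 ≤ ∫ x, ‖fderiv ℝ u x (EuclideanSpace.single 1 1)‖ ^ 2 :=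
    integral_nonneg fun x => by positivity
  generalize (∫ x, ‖u x‖ * ‖fderiv ℝ u x (EuclideanSpace.single 0 1)‖) = A at *
  generalize (∫ x, ‖u x‖ * ‖fderiv ℝ u x (EuclideanSpace.single 1 1)‖) = B at *
  generalize (∫ x, ‖fderiv ℝ u x (EuclideanSpace.single 0 1)‖ ^ 2) = C at *
  generalize (∫ x, ‖fderiv ℝ u x (EuclideanSpace.single 1 1)‖ ^ 2) = D at *
  generalize (∫ x, ‖u x‖ ^ 2) = U at *
  nlinarith [sq_nonneg (A - B)]

lemma aux_pt (a b : EuclideanSpace ℝ (Fin 2))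
    (L : EuclideanSpace ℝ (Fin 2) →L[ℝ] EuclideanSpace ℝ (Fin 2)) :
    |∑ i : Fin 2, ∑ j : Fin 2, a i * L (EuclideanSpace.single i 1) j * b j| ≤
      (‖a‖ * ‖b‖) * √(frobSq2 L) := by
  refine abs_le_of_sq_le_sq ?_ (by positivity)
  rw [mul_pow, mul_pow, Real.sq_sqrt (by unfold frobSq2; positivity)]
  simp only [frobSq2, EuclideanSpace.norm_sq_eq, Fin.sum_univ_two, Real.norm_eq_abs, sq_abs]
  generalize (L (EuclideanSpace.single 0 1)) 0 = p
  generalize (L (EuclideanSpace.single 0 1)) 1 = q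
  generalize (L (EuclideanSpace.single 1 1)) 0 = r
  generalize (L (EuclideanSpace.single 1 1)) 1 = s
  generalize a 0 = a0
  generalize a 1 = a1
  generalize b 0 = b0
  generalize b 1 = b1
  nlinarith [sq_nonneg (a0*b0*q - a0*b1*p), sq_nonneg (a0*b0*r - a1*b0*p),
    sq_nonneg (a0*b0*s - a1*b1*p), sq_nonneg (a0*b1*r - a1*b0*q),
    sq_nonneg (a0*b1*s - a1*b1*q), sq_nonneg (a1*b0*s - a1*b1*r)]

lemma aux_skew (u v w : EuclideanSpace ℝ (Fin 2) → EuclideanSpace ℝ (Fin 2))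
    (hu : ContDiff ℝ (⊤ : ℕ∞) u) (husupp : HasCompactSupport u)
    (hdiv : ∀ x, ∑ i : Fin 2, fderiv ℝ u x (EuclideanSpace.single i 1) i = 0)
    (hv : ContDiff ℝ (⊤ : ℕ∞) v)
    (hw : ContDiff ℝ (⊤ : ℕ∞) w) :
    trilinearB u v w = - trilinearB u w v := by
  have cdu := hu.continuous_fderiv (by simp)
  have cdv := hv.continuous_fderiv (by simp)
  have cdw := hw.continuous_fderiv (by simp)
  have cu := hu.continuous
  have cv := hv.continuous
  have cw := hw.continuous
  have du := hu.differentiable (by simp)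
  have dv := hv.differentiable (by simp)
  have dw := hw.differentiable (by simp)
  have su : ∀ i, HasCompactSupport (fun x => u x i) := fun i =>
    husupp.comp_left (g := fun y : EuclideanSpace ℝ (Fin 2) => y i) (by simp)
  have sdu : ∀ e i, HasCompactSupport (fun x => fderiv ℝ u x e i) := fun e i =>
    (husupp.fderiv_apply (𝕜 := ℝ) e).comp_left
      (g := fun y : EuclideanSpace ℝ (Fin 2) => y i) (by simp)
  have coord : ∀ (z : EuclideanSpace ℝ (Fin 2) → EuclideanSpace ℝ (Fin 2)), Differentiable ℝ z →
      ∀ x e i, fderiv ℝ (fun x => z x i) x e = fderiv ℝ z x e i := by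
    intro z hz x e i
    have := ((EuclideanSpace.proj (𝕜 := ℝ) (i : Fin 2)).hasFDerivAt
      (x := z x)).comp x (hz x).hasFDerivAt
    have h2 := this.fderiv
    change fderiv ℝ (fun x => z x i) x = _ at h2
    rw [h2]; rfl
  let φ : EuclideanSpace ℝ (Fin 2) → ℝ := fun x => v x 0 * w x 0 + v x 1 * w x 1
  have hφ : ∀ x e, fderiv ℝ φ x e = v x 0 * fderiv ℝ w x e 0 + fderiv ℝ v x e 0 * w x 0
      + (v x 1 * fderiv ℝ w x e 1 + fderiv ℝ v x e 1 * w x 1) := by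
    intro x e
    have dvi : ∀ i, DifferentiableAt ℝ (fun x => v x i) x := fun i => by fun_prop
    have dwi : ∀ i, DifferentiableAt ℝ (fun x => w x i) x := fun i => by fun_prop
    have : fderiv ℝ φ x = _ :=
      (((dvi 0).hasFDerivAt.mul (dwi 0).hasFDerivAt).add
        ((dvi 1).hasFDerivAt.mul (dwi 1).hasFDerivAt)).fderiv
    rw [this]
    simp [coord v dv, coord w dw]
    ring
  have dφ : Differentiable ℝ φ := by fun_prop
  have cφ : Continuous φ := dφ.continuous
  have cdφ : ∀ e, Continuous (fun x => fderiv ℝ φ x e) := by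
    intro e
    simp only [hφ]
    fun_prop
  have i1 : ∀ i e, Integrable (fun x => fderiv ℝ u x e i * φ x) := fun i e =>
    Continuous.integrable_of_hasCompactSupport (by fun_prop) (sdu e i).mul_right
  have i2 : ∀ i e, Integrable (fun x => u x i * fderiv ℝ φ x e) := fun i e => by
    have := cdφ e
    exact Continuous.integrable_of_hasCompactSupport (by fun_prop) (su i).mul_right
  have ibp : ∀ i e, ∫ x, u x i * fderiv ℝ φ x e = - ∫ x, fderiv ℝ u x e i * φ x := by
    intro i e
    have := integral_mul_fderiv_eq_neg_fderiv_mul_of_integrable (μ := volume)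
      (f := fun x => u x i) (g := φ) (v := e)
      (by simpa only [coord u du] using i1 i e) (i2 i e)
      (Continuous.integrable_of_hasCompactSupport (by fun_prop) (su i).mul_right)
      (fun x _ => by fun_prop) (fun x _ => dφ x)
    simpa only [coord u du] using this
  have ib : ∀ z y : EuclideanSpace ℝ (Fin 2) → EuclideanSpace ℝ (Fin 2), Continuous (fderiv ℝ z) →
      Continuous y → Integrable (fun x => ∑ i : Fin 2, ∑ j : Fin 2,
        u x i * fderiv ℝ z x (EuclideanSpace.single i 1) j * y x j) := by
    intro z y hz hy
    refine integrable_finsetSum _ fun i _ => integrable_finsetSum _ fun j _ => ?_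
    exact Continuous.integrable_of_hasCompactSupport (by fun_prop) ((su i).mul_right).mul_right
  rw [eq_neg_iff_add_eq_zero, trilinearB, trilinearB,
    ← integral_add (ib v w cdv cw) (ib w v cdw cv)]
  have e1 : (fun x => (∑ i : Fin 2, ∑ j : Fin 2,
      u x i * fderiv ℝ v x (EuclideanSpace.single i 1) j * w x j) + ∑ i : Fin 2, ∑ j : Fin 2,
      u x i * fderiv ℝ w x (EuclideanSpace.single i 1) j * v x j) =
      fun x => u x 0 * fderiv ℝ φ x (EuclideanSpace.single 0 1) +
        u x 1 * fderiv ℝ φ x (EuclideanSpace.single 1 1) := by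
    ext x
    simp only [Fin.sum_univ_two, hφ]
    ring
  rw [e1, integral_add (i2 _ _) (i2 _ _), ibp, ibp, ← neg_add, ← integral_add (i1 _ _) (i1 _ _),
    neg_eq_zero]
  have e2 : ∀ x, fderiv ℝ u x (EuclideanSpace.single 0 1) 0 * φ x +
      fderiv ℝ u x (EuclideanSpace.single 1 1) 1 * φ x = 0 := by
    intro x
    have := hdiv x
    rw [Fin.sum_univ_two] at this
    rw [← add_mul, this, zero_mul]
  simp only [e2, integral_zero]

/-- Estimate (2.5) of the paper:
`|b(u,v,w)| ≤ √2 ‖u‖^{1/2} ‖∇u‖^{1/2} ‖v‖^{1/2} ‖∇v‖^{1/2} ‖∇w‖` in `L²(ℝ²)` norms. -/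
theorem trilinearB_estimate
    (u v w : EuclideanSpace ℝ (Fin 2) → EuclideanSpace ℝ (Fin 2))
    (hu : ContDiff ℝ (⊤ : ℕ∞) u) (husupp : HasCompactSupport u)
    (hdiv : ∀ x, ∑ i : Fin 2, fderiv ℝ u x (EuclideanSpace.single i 1) i = 0)
    (hv : ContDiff ℝ (⊤ : ℕ∞) v) (hvsupp : HasCompactSupport v)
    (hw : ContDiff ℝ (⊤ : ℕ∞) w) (hwsupp : HasCompactSupport w) :
    |trilinearB u v w| ≤
      Real.sqrt 2 *
        ((∫ x, ‖u x‖ ^ 2) ^ ((1 : ℝ) / 2)) ^ ((1 : ℝ) / 2) *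
        ((∫ x, frobSq2 (fderiv ℝ u x)) ^ ((1 : ℝ) / 2)) ^ ((1 : ℝ) / 2) *
        ((∫ x, ‖v x‖ ^ 2) ^ ((1 : ℝ) / 2)) ^ ((1 : ℝ) / 2) *
        ((∫ x, frobSq2 (fderiv ℝ v x)) ^ ((1 : ℝ) / 2)) ^ ((1 : ℝ) / 2) *
        (∫ x, frobSq2 (fderiv ℝ w x)) ^ ((1 : ℝ) / 2) := by
  have hcu := hu.continuous
  have hcv := hv.continuous
  have cdw := hw.continuous_fderiv (by simp)
  have cF : Continuous (fun x => √(frobSq2 (fderiv ℝ w x))) := by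
    unfold frobSq2
    fun_prop
  have sF : HasCompactSupport (fun x => √(frobSq2 (fderiv ℝ w x))) :=
    (hwsupp.fderiv (𝕜 := ℝ)).comp_left (g := fun L => √(frobSq2 L)) (by simp [frobSq2])
  have frob0 : ∀ L, 0 ≤ frobSq2 L := fun L => by unfold frobSq2; positivity
  have b1 : |trilinearB u v w| ≤ ∫ x, (‖u x‖ * ‖v x‖) * √(frobSq2 (fderiv ℝ w x)) := by
    rw [aux_skew u v w hu husupp hdiv hv hw, abs_neg, trilinearB, ← Real.norm_eq_abs]
    have hi : Integrable (fun x => (‖u x‖ * ‖v x‖) * √(frobSq2 (fderiv ℝ w x))) :=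
      Continuous.integrable_of_hasCompactSupport (by fun_prop) sF.mul_left
    refine norm_integral_le_of_norm_le hi (Filter.Eventually.of_forall fun x => ?_)
    exact aux_pt _ _ _
  have b2 := aux_cs (f := fun x => ‖u x‖ * ‖v x‖) (hcu.norm.mul hcv.norm) (husupp.norm.mul_right) cF sF
  have b3 := aux_cs (hcu.norm.pow 2) (by simpa only [pow_two] using husupp.norm.mul_right)
    (hcv.norm.pow 2) (by simpa only [pow_two] using hvsupp.norm.mul_right)
  simp only [Real.sq_sqrt (frob0 _), mul_pow] at b2
  have b4 := aux_lady hu husupp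
  have b5 := aux_lady hv hvsupp
  have pU : 0 ≤ ∫ x, ‖u x‖ ^ 2 := integral_nonneg fun x => by positivity
  have pV : 0 ≤ ∫ x, ‖v x‖ ^ 2 := integral_nonneg fun x => by positivity
  have pU' : 0 ≤ ∫ x, frobSq2 (fderiv ℝ u x) := integral_nonneg fun x => frob0 _
  have pV' : 0 ≤ ∫ x, frobSq2 (fderiv ℝ v x) := integral_nonneg fun x => frob0 _
  have pW' : 0 ≤ ∫ x, frobSq2 (fderiv ℝ w x) := integral_nonneg fun x => frob0 _
  have pV4 : 0 ≤ ∫ x, (‖v x‖ ^ 2) ^ 2 := integral_nonneg fun x => by positivity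
  have pM : 0 ≤ ∫ x, ‖u x‖ ^ 2 * ‖v x‖ ^ 2 := integral_nonneg fun x => by positivity
  refine le_of_pow_le_pow_left₀ (n := 4) (by norm_num) (by positivity) ?_
  simp only [mul_pow]
  have r2 : ∀ a : ℝ, 0 ≤ a → (a ^ ((1 : ℝ) / 2)) ^ 2 = a := fun a ha => by
    rw [← Real.sqrt_eq_rpow, Real.sq_sqrt ha]
  have r4 : ∀ a : ℝ, 0 ≤ a → ((a ^ ((1 : ℝ) / 2)) ^ ((1 : ℝ) / 2)) ^ 4 = a := fun a ha => by
    rw [show (4 : ℕ) = 2 * 2 from rfl, pow_mul, r2 _ (by positivity), r2 _ ha]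
  rw [r4 _ pU, r4 _ pU', r4 _ pV, r4 _ pV', show (4 : ℕ) = 2 * 2 from rfl,
    pow_mul ((∫ x, frobSq2 (fderiv ℝ w x)) ^ ((1 : ℝ) / 2)), r2 _ pW', pow_mul √2,
    Real.sq_sqrt (by norm_num), pow_mul]
  calc (|trilinearB u v w| ^ 2) ^ 2
      ≤ ((∫ x, ‖u x‖ ^ 2 * ‖v x‖ ^ 2) * ∫ x, frobSq2 (fderiv ℝ w x)) ^ 2 := by
        gcongr
        exact (pow_le_pow_left₀ (abs_nonneg _) b1 2).trans b2
    _ = (∫ x, ‖u x‖ ^ 2 * ‖v x‖ ^ 2) ^ 2 * (∫ x, frobSq2 (fderiv ℝ w x)) ^ 2 := by ring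
    _ ≤ ((2 * (∫ x, ‖u x‖ ^ 2) * ∫ x, frobSq2 (fderiv ℝ u x)) *
          (2 * (∫ x, ‖v x‖ ^ 2) * ∫ x, frobSq2 (fderiv ℝ v x))) *
          (∫ x, frobSq2 (fderiv ℝ w x)) ^ 2 := by
        gcongr
        exact b3.trans (mul_le_mul b4 b5 pV4 (by positivity))
    _ = _ := by ring
end

section
/- Let r ∈ (1, 2], and let F : ℝ → ℝ be continuously differentiable and bounded from below (there is m ∈ ℝ with F(s) ≥ m for all s). Suppose there exist constants C₃ > 0 and C₄ ≥ 0 such that |F′(s)|^r ≤ C₃ |F(s)| + C₄ for all s ∈ ℝ. Then there exist constants C₅ > 0 and C₆ ≥ 0 such that |F(s)| ≤ C₅ |s|^{r′} + C₆ for all s ∈ ℝ, where r′ = r/(r−1) is the conjugate exponent of r. -/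
/-- Remark 2.2 / estimate (2.9) of the paper: if `F ∈ C¹(ℝ)` is bounded from below and satisfies
`|F′(s)|^r ≤ C₃|F(s)| + C₄` for some `r ∈ (1,2]`, then `F` has polynomial growth of order
`r′ = r/(r-1)`: there are `C₅ > 0` and `C₆ ≥ 0` with `|F(s)| ≤ C₅|s|^{r′} + C₆`. -/
theorem potential_polynomial_growth
    (r : ℝ) (hr1 : 1 < r) (hr2 : r ≤ 2)
    (F : ℝ → ℝ) (hF : ContDiff ℝ 1 F)
    (m : ℝ) (hbdd : ∀ s, m ≤ F s)
    (C₃ C₄ : ℝ) (hC₃ : 0 < C₃) (hC₄ : 0 ≤ C₄)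
    (hgrowth : ∀ s, |deriv F s| ^ r ≤ C₃ * |F s| + C₄) :
    ∃ C₅ > (0 : ℝ), ∃ C₆ ≥ (0 : ℝ), ∀ s, |F s| ≤ C₅ * |s| ^ (r / (r - 1)) + C₆ := by
  have hr0 : 0 < r := by linarith
  have hr10 : 0 < r - 1 := by linarith
  obtain ⟨G, hG⟩ : ∃ G : ℝ → ℝ, G = fun s => F s - m + 1 := ⟨_, rfl⟩
  have hG1 : ∀ s, 1 ≤ G s := fun s => by rw [hG]; linarith [hbdd s]
  have hG0 : ∀ s, 0 < G s := fun s => by linarith [hG1 s]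
  have hFG : ∀ s, |F s| ≤ (2 + |m|) * G s := by
    intro s
    have h1 : F s = G s + m - 1 := by rw [hG]; ring
    have h2 := hG1 s
    have h3 : |m| * 1 ≤ |m| * G s := mul_le_mul_of_nonneg_left h2 (abs_nonneg m)
    have h4 := neg_abs_le m
    have h5 := le_abs_self m
    rw [abs_le]
    constructor <;> nlinarith
  obtain ⟨K, hK⟩ : ∃ K, K = C₃ * (2 + |m|) + C₄ := ⟨_, rfl⟩
  have hK0 : 0 < K := by rw [hK]; positivity
  have hder : ∀ s, |deriv F s| ≤ K ^ (1 / r) * G s ^ (1 / r) := by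
    intro s
    rw [← Real.mul_rpow hK0.le (hG0 s).le]
    have h1 : |deriv F s| ^ r ≤ K * G s := by
      have := mul_le_mul_of_nonneg_left (hFG s) hC₃.le
      have h2 := mul_le_mul_of_nonneg_left (hG1 s) hC₄
      rw [hK]
      nlinarith [hgrowth s]
    have h2 := Real.rpow_le_rpow (by positivity) h1 (by positivity : 0 ≤ 1 / r)
    rwa [← Real.rpow_mul (abs_nonneg _), mul_one_div_cancel hr0.ne', Real.rpow_one] at h2
  obtain ⟨a, ha⟩ : ∃ a, a = (r - 1) / r := ⟨_, rfl⟩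
  have ha0 : 0 < a := by rw [ha]; positivity
  have ha1 : a - 1 = -(1 / r) := by rw [ha]; field_simp; ring
  obtain ⟨p, hp⟩ : ∃ p, p = r / (r - 1) := ⟨_, rfl⟩
  have hp0 : 0 < p := by rw [hp]; positivity
  have hap : a * p = 1 := by rw [ha, hp]; field_simp
  rw [← hp]
  have hGd : ∀ s, HasDerivAt G (deriv F s) s := by
    intro s
    rw [hG]
    exact (((hF.differentiable (by norm_num)) s).hasDerivAt.sub_const m).add_const 1
  have hHd : ∀ s, HasDerivAt (fun x => G x ^ a) (deriv F s * a * G s ^ (a - 1)) s :=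
    fun s => (hGd s).rpow_const (Or.inl (hG0 s).ne')
  obtain ⟨L, hL⟩ : ∃ L, L = a * K ^ (1 / r) := ⟨_, rfl⟩
  have hL0 : 0 < L := by rw [hL]; positivity
  have hHb : ∀ s, ‖deriv F s * a * G s ^ (a - 1)‖ ≤ L := by
    intro s
    have hg := Real.rpow_pos_of_pos (hG0 s) (a - 1)
    rw [Real.norm_eq_abs, abs_mul, abs_mul, abs_of_pos ha0, abs_of_pos hg]
    calc |deriv F s| * a * G s ^ (a - 1)
        ≤ (K ^ (1 / r) * G s ^ (1 / r)) * a * G s ^ (a - 1) := by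
          gcongr; exact hder s
      _ = L * (G s ^ (1 / r) * G s ^ (a - 1)) := by rw [hL]; ring
      _ = L := by
          rw [← Real.rpow_add (hG0 s), ha1, add_neg_cancel, Real.rpow_zero, mul_one]
  have hlip : ∀ s, G s ^ a ≤ L * |s| + G 0 ^ a := by
    intro s
    have h := Convex.norm_image_sub_le_of_norm_hasDerivWithin_le (s := Set.univ)
      (f := fun x => G x ^ a) (fun x _ => (hHd x).hasDerivWithinAt) (fun x _ => hHb x)
      convex_univ (Set.mem_univ 0) (Set.mem_univ s)
    simp only [Real.norm_eq_abs, sub_zero] at h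
    linarith [le_abs_self (G s ^ a - G 0 ^ a)]
  have hB0 : 0 < G 0 ^ a := Real.rpow_pos_of_pos (hG0 0) a
  have hGb : ∀ s, G s ≤ (2 * L) ^ p * |s| ^ p + (2 * G 0 ^ a) ^ p := by
    intro s
    have h0 : G s = (G s ^ a) ^ p := by
      rw [← Real.rpow_mul (hG0 s).le, hap, Real.rpow_one]
    have hn : 0 ≤ G s ^ a := Real.rpow_nonneg (hG0 s).le a
    rw [← Real.mul_rpow (by positivity) (abs_nonneg s), h0]
    have n1 : 0 ≤ (2 * L * |s|) ^ p := by positivity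
    have n2 : 0 ≤ (2 * G 0 ^ a) ^ p := by positivity
    rcases le_total (L * |s|) (G 0 ^ a) with h | h
    · have := Real.rpow_le_rpow hn (by linarith [hlip s] : G s ^ a ≤ 2 * G 0 ^ a) hp0.le
      linarith
    · have := Real.rpow_le_rpow hn (by linarith [hlip s] : G s ^ a ≤ 2 * L * |s|) hp0.le
      linarith
  refine ⟨(2 + |m|) * (2 * L) ^ p, by positivity, (2 + |m|) * (2 * G 0 ^ a) ^ p,
    by positivity, fun s => ?_⟩
  have := mul_le_mul_of_nonneg_left (hGb s) (by positivity : 0 ≤ 2 + |m|)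
  linarith [hFG s]
end
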